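/- arXiv:0903.2400 — 4 statements merged into one kernel-verified Lean document; each statement's English description precedes it below -/
import Mathlib

section
/- Let (a_n)_{n≥0} be a sequence of integers with a_n ≥ 4 for all n, and let Θ be as defined. Suppose ε⁽¹⁾, ε⁽²⁾ ∈ {−1,0,1}^ℕ satisfy ε⁽¹⁾_n = ε⁽²⁾_n for all n < i₀ and ε⁽¹⁾_{i₀} < ε⁽²⁾_{i₀} for some integer i₀ ≥ 0. Set θ = Θ(ε⁽¹⁾_0, …, ε⁽¹⁾_{i₀}, 0, 0, …) and δ = 1/(a_0 a_1 ⋯ a_{i₀+1}). Then Θ(ε⁽¹⁾) ≤ θ + (1/3)δ < θ + (2/3)δ ≤ Θ(ε⁽²⁾). -/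
open Finset in
/-- `Theta a ε = ∑_{n≥0} ε_n / (a_0 a_1 ⋯ a_{n+1})`. -/
noncomputable def Theta (a : ℕ → ℤ) (ε : ℕ → ℤ) : ℝ :=
  ∑' n : ℕ, (ε n : ℝ) / ∏ j ∈ Finset.range (n + 2), (a j : ℝ)

lemma four_pow_mul_prod_range_le_prod_range {a : ℕ → ℤ} (ha : ∀ n, 4 ≤ a n) (m n : ℕ) :
    (4 : ℝ) ^ n * ∏ j ∈ Finset.range m, (a j : ℝ) ≤ ∏ j ∈ Finset.range (m + n), (a j : ℝ) := by
  rw [Finset.prod_range_add, mul_comm]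
  have h4 : ∀ j, (4 : ℝ) ≤ a j := fun j => by exact_mod_cast ha j
  refine mul_le_mul_of_nonneg_left ?_ (Finset.prod_nonneg fun j _ => by linarith [h4 j])
  simpa using Finset.prod_le_prod (s := Finset.range n) (f := fun _ => (4 : ℝ))
    (g := fun j => (a (m + j) : ℝ)) (fun _ _ => by norm_num) (fun j _ => h4 (m + j))

lemma abs_Theta_sub_sum_range_le {a ε : ℕ → ℤ} (ha : ∀ n, 4 ≤ a n) (hε : ∀ n, |ε n| ≤ 1) (k : ℕ) :
    |Theta a ε - ∑ n ∈ Finset.range (k + 1), (ε n : ℝ) / ∏ j ∈ Finset.range (n + 2), (a j : ℝ)| ≤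
      (1 / 3) * (1 / ∏ j ∈ Finset.range (k + 2), (a j : ℝ)) := by
  set f : ℕ → ℝ := fun n => (ε n : ℝ) / ∏ j ∈ Finset.range (n + 2), (a j : ℝ) with hf
  have hpos : ∀ m, 0 < ∏ j ∈ Finset.range m, (a j : ℝ) := fun m =>
    Finset.prod_pos fun j _ => by exact_mod_cast (by linarith [ha j] : 0 < a j)
  set δ : ℝ := 1 / ∏ j ∈ Finset.range (k + 2), (a j : ℝ) with hδ
  have hbound : ∀ n, ‖f (n + (k + 1))‖ ≤ δ / 4 * (1 / 4) ^ n := by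
    intro n
    have hP := four_pow_mul_prod_range_le_prod_range ha (k + 2) (n + 1)
    have hε' : |(ε (n + (k + 1)) : ℝ)| ≤ 1 := by exact_mod_cast hε _
    have hP0 := hpos (k + 2)
    rw [Real.norm_eq_abs, hf]
    simp only
    rw [show n + (k + 1) + 2 = k + 2 + (n + 1) by ring, abs_div, abs_of_pos (hpos _)]
    calc _ ≤ 1 / ((4 : ℝ) ^ (n + 1) * ∏ j ∈ Finset.range (k + 2), (a j : ℝ)) := by gcongr
      _ = δ / 4 * (1 / 4) ^ n := by
        rw [hδ, one_div_pow, pow_succ]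
        field_simp
  have hgeom : HasSum (fun n : ℕ => δ / 4 * (1 / 4 : ℝ) ^ n) (1 / 3 * δ) := by
    have h := (hasSum_geometric_of_lt_one (r := (1 / 4 : ℝ)) (by norm_num) (by norm_num)).mul_left
      (δ / 4)
    rwa [show δ / 4 * (1 - 1 / 4)⁻¹ = 1 / 3 * δ by ring] at h
  have hsum : Summable f :=
    (summable_nat_add_iff (k + 1)).1 (Summable.of_norm_bounded hgeom.summable hbound)
  have hsplit : Theta a ε - ∑ n ∈ Finset.range (k + 1), f n = ∑' n, f (n + (k + 1)) := by
    rw [sub_eq_iff_eq_add', hsum.sum_add_tsum_nat_add]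
    rfl
  rw [hsplit]
  exact tsum_of_norm_bounded hgeom hbound

lemma Theta_ite_le (a ε : ℕ → ℤ) (k : ℕ) :
    Theta a (fun n => if n ≤ k then ε n else 0) =
      ∑ n ∈ Finset.range (k + 1), (ε n : ℝ) / ∏ j ∈ Finset.range (n + 2), (a j : ℝ) := by
  rw [Theta, tsum_eq_sum (s := Finset.range (k + 1))]
  · refine Finset.sum_congr rfl fun n hn => ?_
    rw [if_pos (Nat.lt_succ_iff.1 (Finset.mem_range.1 hn))]
  · intro n hn
    rw [if_neg fun h => hn (Finset.mem_range.2 (Nat.lt_succ_iff.2 h))]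
    simp

/-- (Lemma 3.1 of the paper.) If `ε⁽¹⁾, ε⁽²⁾ ∈ {-1,0,1}^ℕ` agree below `i₀`
and `ε⁽¹⁾_{i₀} < ε⁽²⁾_{i₀}`, then with `θ = Θ(ε⁽¹⁾_0,…,ε⁽¹⁾_{i₀},0,0,…)` and
`δ = 1/(a_0 ⋯ a_{i₀+1})` one has `Θ(ε⁽¹⁾) ≤ θ + δ/3 < θ + 2δ/3 ≤ Θ(ε⁽²⁾)`. -/
theorem stmt2 (a : ℕ → ℤ) (ha : ∀ n, 4 ≤ a n)
    (ε₁ ε₂ : ℕ → ℤ)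
    (hε₁ : ∀ n, ε₁ n ∈ ({-1, 0, 1} : Set ℤ))
    (hε₂ : ∀ n, ε₂ n ∈ ({-1, 0, 1} : Set ℤ))
    (i₀ : ℕ) (hagree : ∀ n < i₀, ε₁ n = ε₂ n) (hlt : ε₁ i₀ < ε₂ i₀)
    (θ δ : ℝ)
    (hθ : θ = Theta a (fun n => if n ≤ i₀ then ε₁ n else 0))
    (hδ : δ = 1 / ∏ j ∈ Finset.range (i₀ + 2), (a j : ℝ)) :
    Theta a ε₁ ≤ θ + (1 / 3) * δ ∧
      θ + (1 / 3) * δ < θ + (2 / 3) * δ ∧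
        θ + (2 / 3) * δ ≤ Theta a ε₂ := by
  have habs : ∀ x : ℤ, x ∈ ({-1, 0, 1} : Set ℤ) → |x| ≤ 1 := by
    rintro x (rfl | rfl | rfl) <;> norm_num
  have h₁ := abs_le.1 (abs_Theta_sub_sum_range_le ha (fun n => habs _ (hε₁ n)) i₀)
  have h₂ := abs_le.1 (abs_Theta_sub_sum_range_le ha (fun n => habs _ (hε₂ n)) i₀)
  have hδ0 : 0 < δ := by
    rw [hδ]
    exact one_div_pos.2 (Finset.prod_pos fun j _ => by
      exact_mod_cast (by linarith [ha j] : 0 < a j))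
  rw [Theta_ite_le] at hθ
  rw [← hδ, ← hθ] at h₁
  rw [← hδ] at h₂
  have hstep : θ + δ ≤ ∑ n ∈ Finset.range (i₀ + 1),
      (ε₂ n : ℝ) / ∏ j ∈ Finset.range (n + 2), (a j : ℝ) := by
    have hlt' : (ε₁ i₀ : ℝ) + 1 ≤ ε₂ i₀ := by exact_mod_cast hlt
    have hmul := mul_le_mul_of_nonneg_right hlt' hδ0.le
    rw [hθ, Finset.sum_range_succ, Finset.sum_range_succ, Finset.sum_congr rfl fun n hn => by
      rw [hagree n (Finset.mem_range.1 hn)], div_eq_mul_one_div (ε₁ i₀ : ℝ),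
      div_eq_mul_one_div (ε₂ i₀ : ℝ), ← hδ]
    linarith
  exact ⟨by linarith [h₁.2], by linarith, by linarith [h₂.1]⟩
end

section
/- The function R(δ) = log(1 + e^{−2πδ}) / (−log(1 − e^{−2πδ})), defined for δ > 0, is continuous and strictly increasing, satisfies 0 < R(δ) < 1 for all δ > 0, and R(δ) → 0 as δ → 0⁺ and R(δ) → 1 as δ → +∞. -/
open Real Set Filter

/-- The amplitude ratio `R(δ) = log(1 + e^{-2πδ}) / (-log(1 - e^{-2πδ}))`. -/
noncomputable def ampR (δ : ℝ) : ℝ :=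
  Real.log (1 + Real.exp (-2 * π * δ)) / (-Real.log (1 - Real.exp (-2 * π * δ)))

/-- The function `log (1 + x) / (-log (1 - x))`, whose composition with `δ ↦ e^{-2πδ}`
is `ampR`. -/
noncomputable def logRatio (x : ℝ) : ℝ :=
  Real.log (1 + x) / (-Real.log (1 - x))

lemma neg_log_one_sub_pos {x : ℝ} (hx : x ∈ Ioo (0 : ℝ) 1) : 0 < -Real.log (1 - x) :=
  neg_pos.2 (Real.log_neg (by linarith [hx.2]) (by linarith [hx.1]))

lemma logRatio_pos {x : ℝ} (hx : x ∈ Ioo (0 : ℝ) 1) : 0 < logRatio x :=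
  div_pos (Real.log_pos (by linarith [hx.1])) (neg_log_one_sub_pos hx)

lemma logRatio_lt_one {x : ℝ} (hx : x ∈ Ioo (0 : ℝ) 1) : logRatio x < 1 := by
  obtain ⟨h0, h1⟩ := hx
  rw [logRatio, div_lt_one (neg_log_one_sub_pos ⟨h0, h1⟩)]
  have hadd := Real.log_lt_sub_one_of_pos (x := 1 + x) (by linarith) (by linarith)
  have hsub := Real.log_lt_sub_one_of_pos (x := 1 - x) (by linarith) (by linarith)
  linarith

lemma continuousOn_logRatio : ContinuousOn logRatio (Ioo 0 1) := by
  refine ContinuousOn.div ?_ ?_ fun x hx => (neg_log_one_sub_pos hx).ne'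
  · exact ContinuousOn.log (by fun_prop) fun x hx => by linarith [hx.1]
  · exact (ContinuousOn.log (by fun_prop) fun x hx => by linarith [hx.2]).neg

lemma strictAntiOn_logRatio : StrictAntiOn logRatio (Ioo 0 1) := by
  intro x hx y hy hxy
  have hx0 := hx.1
  have hy0 := hy.1
  have hy1 := hy.2
  have hadd := strictConcaveOn_log_Ioi.secant_strict_mono (a := 1) (x := 1 + x) (y := 1 + y)
    (mem_Ioi.2 one_pos) (mem_Ioi.2 (by linarith)) (mem_Ioi.2 (by linarith)) (by linarith)
    (by linarith) (by linarith)
  have hsub := strictConcaveOn_log_Ioi.secant_strict_mono (a := 1) (x := 1 - y) (y := 1 - x)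
    (mem_Ioi.2 one_pos) (mem_Ioi.2 (by linarith)) (mem_Ioi.2 (by linarith)) (by linarith)
    (by linarith) (by linarith)
  simp only [Real.log_one, sub_zero, add_sub_cancel_left, sub_sub_cancel_left, div_neg,
    ← neg_div] at hadd hsub
  have hmul := mul_lt_mul'' hadd hsub
    (div_nonneg (Real.log_nonneg (by linarith)) hy0.le)
    (div_nonneg (neg_log_one_sub_pos hx).le hx0.le)
  rw [div_mul_div_comm, div_mul_div_comm, mul_comm y x,
    div_lt_div_iff_of_pos_right (mul_pos hx0 hy0)] at hmul
  rwa [logRatio, logRatio, div_lt_div_iff₀ (neg_log_one_sub_pos hy) (neg_log_one_sub_pos hx)]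

lemma tendsto_logRatio_nhdsLT_one : Tendsto logRatio (nhdsWithin 1 (Iio 1)) (nhds 0) := by
  have hnum : Tendsto (fun x : ℝ => Real.log (1 + x)) (nhdsWithin 1 (Iio 1))
      (nhds (Real.log (1 + 1))) :=
    (ContinuousAt.log (by fun_prop) (by norm_num)).tendsto.mono_left nhdsWithin_le_nhds
  have hsub : Tendsto (fun x : ℝ => 1 - x) (nhdsWithin 1 (Iio 1)) (nhdsWithin 0 (Ioi 0)) := by
    refine tendsto_nhdsWithin_iff.2 ⟨?_, ?_⟩
    · exact (Continuous.tendsto' (by fun_prop) 1 0 (sub_self 1)).mono_left nhdsWithin_le_nhds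
    · filter_upwards [self_mem_nhdsWithin] with x hx using sub_pos.2 (mem_Iio.1 hx)
  exact hnum.div_atTop (tendsto_neg_atBot_atTop.comp (Real.tendsto_log_nhdsGT_zero.comp hsub))

lemma tendsto_logRatio_nhdsGT_zero : Tendsto logRatio (nhdsWithin 0 (Ioi 0)) (nhds 1) := by
  have hadd : HasDerivAt (fun x : ℝ => Real.log (1 + x)) 1 0 := by
    simpa using ((hasDerivAt_id (0 : ℝ)).const_add 1).log (by norm_num)
  have hsub : HasDerivAt (fun x : ℝ => -Real.log (1 - x)) 1 0 := by
    simpa [Pi.neg_def] using (((hasDerivAt_id (0 : ℝ)).const_sub 1).log (by norm_num)).neg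
  have hdiv := (hasDerivAt_iff_tendsto_slope.1 hadd).div (hasDerivAt_iff_tendsto_slope.1 hsub)
    one_ne_zero
  rw [div_one] at hdiv
  refine (hdiv.mono_left (nhdsWithin_mono 0 fun x hx => (mem_Ioi.1 hx).ne')).congr' ?_
  filter_upwards [self_mem_nhdsWithin] with x hx
  have hx0 : x ≠ 0 := (mem_Ioi.1 hx).ne'
  simp [slope_def_field, logRatio, div_div_div_cancel_right₀ hx0]

lemma exp_neg_two_pi_mul_mem_Ioo {δ : ℝ} (hδ : δ ∈ Ioi (0 : ℝ)) :
    Real.exp (-2 * π * δ) ∈ Ioo (0 : ℝ) 1 :=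
  ⟨Real.exp_pos _, Real.exp_lt_one_iff.2 (by nlinarith [mul_pos Real.pi_pos (mem_Ioi.1 hδ)])⟩

lemma strictAnti_exp_neg_two_pi_mul : StrictAnti fun δ : ℝ => Real.exp (-2 * π * δ) := by
  intro a b hab
  exact Real.exp_lt_exp.2 (by nlinarith [mul_lt_mul_of_pos_left hab Real.pi_pos])

/-- The function `R(δ) = log(1+e^{-2πδ})/(-log(1-e^{-2πδ}))` is continuous
and strictly increasing on `(0,∞)`, satisfies `0 < R(δ) < 1` for all `δ > 0`, tends to `0`
as `δ → 0⁺` and to `1` as `δ → +∞`. -/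
theorem stmt8 :
    ContinuousOn ampR (Ioi 0) ∧
      StrictMonoOn ampR (Ioi 0) ∧
        (∀ δ > (0 : ℝ), 0 < ampR δ ∧ ampR δ < 1) ∧
          Tendsto ampR (nhdsWithin 0 (Ioi 0)) (nhds 0) ∧
            Tendsto ampR atTop (nhds 1) := by
  have hcomp : ampR = logRatio ∘ fun δ => Real.exp (-2 * π * δ) := rfl
  rw [hcomp]
  refine ⟨?_, ?_, ?_, ?_, ?_⟩
  · exact continuousOn_logRatio.comp (by fun_prop) fun δ => exp_neg_two_pi_mul_mem_Ioo
  · intro a ha b hb hab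
    exact strictAntiOn_logRatio (exp_neg_two_pi_mul_mem_Ioo hb) (exp_neg_two_pi_mul_mem_Ioo ha)
      (strictAnti_exp_neg_two_pi_mul hab)
  · exact fun δ hδ => ⟨logRatio_pos (exp_neg_two_pi_mul_mem_Ioo hδ),
      logRatio_lt_one (exp_neg_two_pi_mul_mem_Ioo hδ)⟩
  · refine tendsto_logRatio_nhdsLT_one.comp (tendsto_nhdsWithin_iff.2 ⟨?_, ?_⟩)
    · exact (Continuous.tendsto' (by fun_prop) 0 1 (by simp)).mono_left nhdsWithin_le_nhds
    · filter_upwards [self_mem_nhdsWithin] with δ hδ using (exp_neg_two_pi_mul_mem_Ioo hδ).2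
  · exact tendsto_logRatio_nhdsGT_zero.comp (Real.tendsto_exp_atBot_nhdsGT.comp
      (tendsto_id.const_mul_atTop_of_neg (by linarith [Real.pi_pos])))
end

section
/- For every y > 0, K(iy) = i·h(y), where h(y) = −(1/(2π)) · log(−log(1 − e^{−2πy})); moreover h : (0, ∞) → ℝ is continuous and strictly increasing, h(y) → −∞ as y → 0⁺ and h(y) → +∞ as y → +∞, so h is a bijection from (0, ∞) onto ℝ. -/
open Real Set Filter

/-- `K(z) = (1/(2πi)) log(-log(1 - e^{2πiz}))` (principal branches). -/
noncomputable def Kfun (z : ℂ) : ℂ :=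
  (1 / (2 * Real.pi * Complex.I)) *
    Complex.log (-Complex.log (1 - Complex.exp (2 * Real.pi * Complex.I * z)))

/-- `h(y) = -(1/(2π)) log(-log(1 - e^{-2πy}))` (real logarithms). -/
noncomputable def hfun (y : ℝ) : ℝ :=
  -(1 / (2 * π)) * Real.log (-Real.log (1 - Real.exp (-2 * π * y)))

theorem one_sub_exp_mem_Ioo {y : ℝ} (hy : 0 < y) :
    1 - Real.exp (-2 * π * y) ∈ Ioo (0 : ℝ) 1 := by
  have h : Real.exp (-2 * π * y) < 1 := Real.exp_lt_one_iff.2 (by nlinarith [mul_pos Real.pi_pos hy])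
  exact ⟨by linarith, by linarith [Real.exp_pos (-2 * π * y)]⟩

theorem neg_log_one_sub_exp_pos {y : ℝ} (hy : 0 < y) :
    0 < -Real.log (1 - Real.exp (-2 * π * y)) := by
  obtain ⟨h0, h1⟩ := one_sub_exp_mem_Ioo hy
  linarith [Real.log_neg h0 h1]

theorem Kfun_I_mul {y : ℝ} (hy : 0 < y) : Kfun (Complex.I * y) = Complex.I * hfun y := by
  have hexp : 2 * (π : ℂ) * Complex.I * (Complex.I * y) = ((-2 * π * y : ℝ) : ℂ) := by
    push_cast
    linear_combination 2 * (π : ℂ) * y * Complex.I_mul_I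
  have hone : (1 : ℂ) - Complex.exp ((-2 * π * y : ℝ) : ℂ) =
      ((1 - Real.exp (-2 * π * y) : ℝ) : ℂ) := by
    push_cast
    rfl
  rw [Kfun, hfun, hexp, hone, ← Complex.ofReal_log (one_sub_exp_mem_Ioo hy).1.le,
    ← Complex.ofReal_neg, ← Complex.ofReal_log (neg_log_one_sub_exp_pos hy).le,
    Complex.ofReal_mul, ← mul_assoc]
  congr 1
  push_cast
  rw [one_div, mul_inv, Complex.inv_I]
  ring

theorem continuousOn_hfun : ContinuousOn hfun (Ioi 0) := by
  unfold hfun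
  refine continuousOn_const.mul (ContinuousOn.log (ContinuousOn.neg (ContinuousOn.log
    (by fun_prop) ?_)) ?_)
  · exact fun y hy => (one_sub_exp_mem_Ioo hy).1.ne'
  · exact fun y hy => (neg_log_one_sub_exp_pos hy).ne'

theorem strictMonoOn_hfun : StrictMonoOn hfun (Ioi 0) := by
  intro x hx y hy hxy
  have hexp : Real.exp (-2 * π * y) < Real.exp (-2 * π * x) :=
    Real.exp_lt_exp.2 (by nlinarith [mul_pos Real.pi_pos (sub_pos.2 hxy)])
  have hlog := Real.log_lt_log (one_sub_exp_mem_Ioo hx).1 (sub_lt_sub_left hexp 1)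
  have hloglog := Real.log_lt_log (neg_log_one_sub_exp_pos hy) (neg_lt_neg hlog)
  exact mul_lt_mul_of_neg_left hloglog (neg_lt_zero.2 (by positivity))

theorem tendsto_hfun_nhdsGT_zero : Tendsto hfun (nhdsWithin 0 (Ioi 0)) atBot := by
  have h : Tendsto (fun y : ℝ => 1 - Real.exp (-2 * π * y)) (nhdsWithin 0 (Ioi 0))
      (nhdsWithin 0 (Ioi 0)) := by
    refine tendsto_nhdsWithin_iff.2 ⟨?_, ?_⟩
    · have hc : Continuous fun y : ℝ => 1 - Real.exp (-2 * π * y) := by fun_prop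
      simpa using (hc.tendsto 0).mono_left nhdsWithin_le_nhds
    · filter_upwards [self_mem_nhdsWithin] with y hy using (one_sub_exp_mem_Ioo hy).1
  exact (Real.tendsto_log_atTop.comp (tendsto_neg_atBot_atTop.comp
    (Real.tendsto_log_nhdsGT_zero.comp h))).const_mul_atTop_of_neg
      (neg_lt_zero.2 (by positivity))

theorem tendsto_hfun_atTop : Tendsto hfun atTop atTop := by
  have hexp : Tendsto (fun y : ℝ => Real.exp (-2 * π * y)) atTop (nhds 0) :=
    Real.tendsto_exp_atBot.comp
      (tendsto_id.const_mul_atTop_of_neg (by linarith [Real.pi_pos]))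
  have h : Tendsto (fun y : ℝ => -Real.log (1 - Real.exp (-2 * π * y))) atTop
      (nhdsWithin 0 (Ioi 0)) := by
    refine tendsto_nhdsWithin_iff.2 ⟨?_, ?_⟩
    · simpa using ((hexp.const_sub 1).log (by norm_num)).neg
    · filter_upwards [eventually_gt_atTop 0] with y hy using neg_log_one_sub_exp_pos hy
  exact (Real.tendsto_log_nhdsGT_zero.comp h).const_mul_atBot_of_neg
    (neg_lt_zero.2 (by positivity))

theorem bijOn_hfun : BijOn hfun (Ioi 0) univ :=
  ⟨mapsTo_univ _ _, strictMonoOn_hfun.injOn,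
    isPreconnected_Ioi.intermediate_value_Iii (le_principal_iff.2 self_mem_nhdsWithin)
      (le_principal_iff.2 (Ioi_mem_atTop 0)) continuousOn_hfun tendsto_hfun_nhdsGT_zero
      tendsto_hfun_atTop⟩

/-- For `y > 0`, `K(iy) = i·h(y)` where
`h(y) = -(1/(2π)) log(-log(1 - e^{-2πy}))`; moreover `h` is continuous and strictly
increasing on `(0,∞)`, tends to `-∞` at `0⁺` and to `+∞` at `+∞`, hence is a bijection
from `(0,∞)` onto `ℝ`. -/
theorem stmt12 :
    (∀ y : ℝ, 0 < y → Kfun (Complex.I * y) = Complex.I * (hfun y)) ∧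
      ContinuousOn hfun (Ioi 0) ∧
        StrictMonoOn hfun (Ioi 0) ∧
          Tendsto hfun (nhdsWithin 0 (Ioi 0)) atBot ∧
            Tendsto hfun atTop atTop ∧
              Set.BijOn hfun (Ioi 0) Set.univ :=
  ⟨fun _ hy => Kfun_I_mul hy, continuousOn_hfun, strictMonoOn_hfun, tendsto_hfun_nhdsGT_zero,
    tendsto_hfun_atTop, bijOn_hfun⟩
end

section
/- Let (a_j)_{j≥0} be a sequence of positive integers. For each n ≥ 1 define subsets A_{j,n} ⊆ ℝ for 0 ≤ j ≤ n by downward recursion: A_{n,n} = ℝ, and A_{j,n} = (1/a_j) · (ℤ + (A_{j+1,n} ∩ [−2/a_{j+1}, 2/a_{j+1}])) for j = n−1, n−2, …, 0. Then for every n ≥ 1, A_{0,n+1} ⊆ A_{0,n}. -/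
/-- One folding step: `step aj aj1 S = (1/aj) · (ℤ + (S ∩ [-2/aj1, 2/aj1]))`. -/
def stepSet (aj aj1 : ℝ) (S : Set ℝ) : Set ℝ :=
  {x : ℝ | ∃ (m : ℤ) (s : ℝ), s ∈ S ∩ Set.Icc (-2 / aj1) (2 / aj1) ∧ x = ((m : ℝ) + s) / aj}

/-- `Aaux a n k = A_{n-k, n}`:  `A_{n,n} = ℝ` and
`A_{j,n} = (1/a_j)(ℤ + (A_{j+1,n} ∩ [-2/a_{j+1}, 2/a_{j+1}]))` for `j = n-1, …, 0`.
In particular `Aaux a n n = A_{0,n}`. -/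
def Aaux (a : ℕ → ℕ) (n : ℕ) : ℕ → Set ℝ
  | 0 => Set.univ
  | k + 1 => stepSet (a (n - k - 1)) (a (n - k)) (Aaux a n k)

theorem stepSet_mono (aj aj1 : ℝ) {S T : Set ℝ} (h : S ⊆ T) :
    stepSet aj aj1 S ⊆ stepSet aj aj1 T := by
  rintro x ⟨m, s, ⟨hs, hI⟩, rfl⟩
  exact ⟨m, s, ⟨h hs, hI⟩, rfl⟩

/-- `A_{n-k,n+1} ⊆ A_{n-k,n}`. -/
theorem Aaux_succ_succ_subset (a : ℕ → ℕ) (n k : ℕ) :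
    Aaux a (n + 1) (k + 1) ⊆ Aaux a n k := by
  induction k with
  | zero => exact Set.subset_univ _
  | succ k ih =>
    rw [Aaux, Aaux, Nat.add_sub_add_right]
    exact stepSet_mono _ _ ih

/-- For any sequence of positive integers `(a_j)`, the sets of admissible
times are nested: `A_{0,n+1} ⊆ A_{0,n}` for every `n ≥ 1`. -/
theorem stmt16 (a : ℕ → ℕ) (ha : ∀ j, 0 < a j) :
    ∀ n : ℕ, 1 ≤ n → Aaux a (n + 1) (n + 1) ⊆ Aaux a n n := by
  intro n _
  exact Aaux_succ_succ_subset a n n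
end
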